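/- Let n, n̄ ≥ 0, let A ∈ GL_n(ℚ), Ā ∈ GL_n̄(ℚ), and let L ≤ ℤ^n ∩ A⁻¹(ℤ^n) and L̄ ≤ ℤ^n̄ ∩ Ā⁻¹(ℤ^n̄) be finite-index subgroups. If G(A,L) ≅ G(Ā,L̄), then n = n̄ and Ā is conjugate in GL_n(ℚ) to either A or A⁻¹. -/

import Mathlib

open Matrix

noncomputable section

/-- The coercion `ℤ^n → ℚ^n` as an additive homomorphism. -/
def ZtoQ (n : ℕ) : (Fin n → ℤ) →+ (Fin n → ℚ) :=
  AddMonoidHom.mk' (fun v i => (v i : ℚ)) (by intro a b; funext i; simp)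

/-- The image `A·L ⊆ ℚ^n` of a subgroup `L ≤ ℤ^n` under the matrix `A`. -/
def QImage {n : ℕ} (A : Matrix (Fin n) (Fin n) ℚ) (L : AddSubgroup (Fin n → ℤ)) :
    AddSubgroup (Fin n → ℚ) :=
  (L.map (ZtoQ n)).map A.mulVecLin.toAddMonoidHom

/-- The subgroup `AL` of `ℤ^n`, i.e. the set of integer vectors lying in `A·L`. -/
def ALsub {n : ℕ} (A : Matrix (Fin n) (Fin n) ℚ) (L : AddSubgroup (Fin n → ℤ)) :
    AddSubgroup (Fin n → ℤ) :=
  (QImage A L).comap (ZtoQ n)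

/-- `x^v = x_1^{v_1} ⋯ x_n^{v_n}` in the free group on `x_1,…,x_n,t`. -/
def xWord (n : ℕ) (v : Fin n → ℤ) : FreeGroup (Fin n ⊕ Unit) :=
  (List.ofFn fun i => (FreeGroup.of (Sum.inl i) : FreeGroup (Fin n ⊕ Unit)) ^ (v i)).prod

/-- The relations of the Leary–Minasyan group `G(A,L)`. -/
def LMrels (n : ℕ) (A : Matrix (Fin n) (Fin n) ℚ) (L : AddSubgroup (Fin n → ℤ)) :
    Set (FreeGroup (Fin n ⊕ Unit)) :=
  {r | (∃ i j : Fin n,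
          r = FreeGroup.of (Sum.inl i) * FreeGroup.of (Sum.inl j) *
              (FreeGroup.of (Sum.inl i))⁻¹ * (FreeGroup.of (Sum.inl j))⁻¹) ∨
       (∃ v ∈ L, ∃ w : Fin n → ℤ, ZtoQ n w = A.mulVec (ZtoQ n v) ∧
          r = FreeGroup.of (Sum.inr ()) * xWord n v * (FreeGroup.of (Sum.inr ()))⁻¹ *
              (xWord n w)⁻¹)}

/-- The Leary–Minasyan group `G(A,L)`. -/
abbrev LM (n : ℕ) (A : Matrix (Fin n) (Fin n) ℚ) (L : AddSubgroup (Fin n → ℤ)) :=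
  PresentedGroup (LMrels n A L)

/-- The generator `x_i` of `G(A,L)`. -/
def Xg (n : ℕ) (A : Matrix (Fin n) (Fin n) ℚ) (L : AddSubgroup (Fin n → ℤ)) (i : Fin n) :
    LM n A L :=
  PresentedGroup.of (Sum.inl i)

/-- The stable letter `t` of `G(A,L)`. -/
def Tg (n : ℕ) (A : Matrix (Fin n) (Fin n) ℚ) (L : AddSubgroup (Fin n → ℤ)) : LM n A L :=
  PresentedGroup.of (Sum.inr ())

/-- The element `x^v` of `G(A,L)`. -/
def Xv (n : ℕ) (A : Matrix (Fin n) (Fin n) ℚ) (L : AddSubgroup (Fin n → ℤ)) (v : Fin n → ℤ) :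
    LM n A L :=
  (List.ofFn fun i => (Xg n A L i) ^ (v i)).prod

/-- The base subgroup `H = ⟨x_1,…,x_n⟩` of `G(A,L)`. -/
def Hsub (n : ℕ) (A : Matrix (Fin n) (Fin n) ℚ) (L : AddSubgroup (Fin n → ℤ)) :
    Subgroup (LM n A L) :=
  Subgroup.closure (Set.range (Xg n A L))

/-- The set `⋃_{j∈ℤ} A^j(ℤ^n) ⊆ ℚ^n`. -/
def unionSet {n : ℕ} (A : Matrix (Fin n) (Fin n) ℚ) : Set (Fin n → ℚ) :=
  ⋃ j : ℤ, (A ^ j).mulVec '' Set.range (ZtoQ n)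

/-- Cast an integer matrix to a rational matrix. -/
def QMat {k : ℕ} (M : Matrix (Fin k) (Fin k) ℤ) : Matrix (Fin k) (Fin k) ℚ :=
  M.map (Int.cast)

/-- The block matrix `[[1, 0ᵀ],[u, C]]`. -/
def blockOne {k : ℕ} (u : Fin k → ℤ) (C : Matrix (Fin k) (Fin k) ℤ) :
    Matrix (Fin (k+1)) (Fin (k+1)) ℤ :=
  Matrix.of fun i j =>
    Fin.cases (Fin.cases 1 (fun _ => 0) j) (fun i' => Fin.cases (u i') (fun j' => C i' j') j) i

/-- Transport a subgroup of `ℤ^a` along an equality `a = b` of dimensions. -/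
def reindexSub {a b : ℕ} (h : a = b) (L : AddSubgroup (Fin a → ℤ)) :
    AddSubgroup (Fin b → ℤ) :=
  L.map (AddMonoidHom.mk' (fun v => v ∘ (finCongr h).symm) (fun _ _ => rfl))

namespace HNNExtension

open NormalWord

variable {G : Type*} [Group G] {A B : Subgroup G}

/-- Consecutive letters `t ^ u * g` and `t ^ v * h` of a word do not cancel. -/
def NoCancel (A B : Subgroup G) (a b : ℤˣ × G) : Prop :=
  a.2 ∈ toSubgroup A B a.1 → a.1 = b.1

theorem isChain_noCancel_append {l l' : List (ℤˣ × G)} {u : ℤˣ} {a a' : G}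
    (hl : (l ++ [(u, a)]).IsChain (NoCancel A B)) (hl' : l'.IsChain (NoCancel A B))
    (h : ∀ y ∈ l'.head?, a' ∈ toSubgroup A B u → u = y.1) :
    (l ++ (u, a') :: l').IsChain (NoCancel A B) := by
  rw [List.isChain_append] at hl ⊢
  refine ⟨hl.1, List.isChain_cons.2 ⟨fun y hy => h y hy, hl'⟩, fun x hx y hy => ?_⟩
  have := hl.2.2 x hx (u, a) (by simp)
  simp only [List.head?_cons, Option.mem_def, Option.some.injEq] at hy
  subst hy
  exact this

variable (φ : A ≃* B)

/-- The element of the HNN extension spelled by a list of letters `t ^ u * g`. -/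
def wordProd (l : List (ℤˣ × G)) : HNNExtension G A B φ :=
  (l.map fun x => t ^ (x.1 : ℤ) * of x.2).prod

@[simp]
theorem wordProd_nil : wordProd φ [] = 1 := rfl

@[simp]
theorem wordProd_cons (x : ℤˣ × G) (l : List (ℤˣ × G)) :
    wordProd φ (x :: l) = t ^ (x.1 : ℤ) * of x.2 * wordProd φ l := by
  simp [wordProd]

@[simp]
theorem wordProd_append (l l' : List (ℤˣ × G)) :
    wordProd φ (l ++ l') = wordProd φ l * wordProd φ l' := by
  simp [wordProd]

theorem exists_eq_of_mul_wordProd (k : HNNExtension G A B φ) :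
    ∃ (g : G) (l : List (ℤˣ × G)), l.IsChain (NoCancel A B) ∧ k = of g * wordProd φ l := by
  obtain ⟨d⟩ := TransversalPair.nonempty G A B
  obtain ⟨w, rfl⟩ := (NormalWord.equiv φ d).symm.surjective k
  exact ⟨w.head, w.toList, w.chain, rfl⟩

variable {φ}

theorem map_fst_eq_of_mul_wordProd_eq {g g' : G} {l l' : List (ℤˣ × G)}
    (hl : l.IsChain (NoCancel A B)) (hl' : l'.IsChain (NoCancel A B))
    (h : of g * wordProd φ l = of g' * wordProd φ l') :
    l.map Prod.fst = l'.map Prod.fst ∧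
      ∀ u ∈ l.head?.map Prod.fst, g⁻¹ * g' ∈ toSubgroup A B (-u) :=
  ReducedWord.map_fst_eq_and_of_prod_eq φ (w₁ := ⟨g, l, hl⟩) (w₂ := ⟨g', l', hl'⟩) h

theorem exists_t_zpow_mul_of_eq (u : ℤˣ) {a : G} (ha : a ∈ toSubgroup A B u) :
    ∃ b : G, (t ^ (u : ℤ) * of a : HNNExtension G A B φ) = of b * t ^ (u : ℤ) := by
  rcases Int.units_eq_one_or u with rfl | rfl
  · exact ⟨φ ⟨a, ha⟩, by simpa using t_mul_of (φ := φ) ⟨a, ha⟩⟩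
  · exact ⟨φ.symm ⟨a, ha⟩, by simpa using inv_t_mul_of (φ := φ) ⟨a, ha⟩⟩

/-- An element which is not conjugate into the base group is conjugate to one
spelled by a nonempty cyclically reduced word. -/
theorem exists_conj_eq_cyclically_reduced {k : HNNExtension G A B φ}
    (hk : ∀ g, g * k * g⁻¹ ∉ (of : G →* HNNExtension G A B φ).range) :
    ∃ (g : HNNExtension G A B φ) (l : List (ℤˣ × G)) (u : ℤˣ) (a : G),
      (l ++ [(u, a)]).IsChain (NoCancel A B) ∧
      (∀ y ∈ (l ++ [(u, a)]).head?, a ∈ toSubgroup A B u → u = y.1) ∧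
      g * k * g⁻¹ = wordProd φ (l ++ [(u, a)]) := by
  classical
  have hex : ∃ (r : ℕ) (g : HNNExtension G A B φ) (b : G) (l : List (ℤˣ × G)),
      l.IsChain (NoCancel A B) ∧ g * k * g⁻¹ = of b * wordProd φ l ∧ l.length = r := by
    obtain ⟨b, l, hl, h⟩ := exists_eq_of_mul_wordProd φ k
    exact ⟨_, 1, b, l, hl, by simpa using h, rfl⟩
  obtain ⟨g, b, l, hl, hg, hr⟩ := Nat.find_spec hex
  have hmin := fun m (hm : m < Nat.find hex) => Nat.find_min hex hm
  rw [← hr] at hmin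
  clear hr
  rcases List.eq_nil_or_concat l with rfl | ⟨l, ⟨u, a⟩, rfl⟩
  · exact absurd ⟨b, by simp [hg]⟩ (hk g)
  rw [List.concat_eq_append] at *
  refine ⟨(of b)⁻¹ * g, l, u, a * b, ?_, ?_, ?_⟩
  · exact isChain_noCancel_append hl (by simp) (by simp)
  · rcases l with _ | ⟨⟨v, c⟩, l⟩
    · simp
    · simp only [List.cons_append, List.head?_cons, Option.mem_def, Option.some.injEq,
        forall_eq']
      intro ha
      by_contra hne
      obtain rfl : v = -u := by
        rcases Int.units_eq_one_or u with rfl | rfl <;>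
        rcases Int.units_eq_one_or v with rfl | rfl <;> simp_all
      obtain ⟨d, hd⟩ := exists_t_zpow_mul_of_eq (φ := φ) u ha
      refine hmin l.length (by simp) ⟨t ^ (u : ℤ) * of a * g, d * c, l, ?_, ?_, rfl⟩
      · exact (List.isChain_append.1 (List.isChain_cons.1 hl).2).1
      · have : t ^ (u : ℤ) * of a * g * k * (t ^ (u : ℤ) * of a * g)⁻¹ =
            (t ^ (u : ℤ) * of a) * (g * k * g⁻¹) * (t ^ (u : ℤ) * of a)⁻¹ := by group
        rw [this, hg]
        have hd' : t ^ (u : ℤ) * of a * of b = (of d * t ^ (u : ℤ) : HNNExtension G A B φ) := by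
          rw [← hd, map_mul, mul_assoc]
        simp only [List.cons_append, wordProd_cons, wordProd_append, wordProd_nil, mul_one,
          Units.val_neg, _root_.zpow_neg, map_mul]
        calc _ = (t ^ (u : ℤ) * of a * of b) * (t ^ (u : ℤ))⁻¹ * of c * wordProd φ l := by group
          _ = _ := by rw [hd']; group
  · have : (of b)⁻¹ * g * k * ((of b)⁻¹ * g)⁻¹ = (of b)⁻¹ * (g * k * g⁻¹) * of b := by group
    rw [this, hg]
    simp [mul_assoc]

theorem exists_wordProd_eq_pow {l : List (ℤˣ × G)} {u : ℤˣ} {a : G}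
    (hl : (l ++ [(u, a)]).IsChain (NoCancel A B))
    (hc : ∀ y ∈ (l ++ [(u, a)]).head?, a ∈ toSubgroup A B u → u = y.1) (m : ℕ) :
    ∃ l' : List (ℤˣ × G), (l' ++ [(u, a)]).IsChain (NoCancel A B) ∧
      (l' ++ [(u, a)]).head? = (l ++ [(u, a)]).head? ∧
      wordProd φ (l' ++ [(u, a)]) = wordProd φ (l ++ [(u, a)]) ^ (m + 1) := by
  induction m with
  | zero => exact ⟨l, hl, rfl, by simp⟩
  | succ m ih =>
    obtain ⟨l', h1, h2, h3⟩ := ih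
    refine ⟨l ++ (u, a) :: l', ?_, ?_, ?_⟩
    · rw [List.append_assoc]
      exact isChain_noCancel_append hl h1 fun y hy => hc y (h2 ▸ hy)
    · cases l <;> simp
    · rw [pow_succ', ← h3]
      simp [mul_assoc]

/-- If some element which is not conjugate into the base group commutes with a power of each of
its conjugates, then both associated subgroups are the whole base group. -/
theorem eq_top_of_commute_conj {k : HNNExtension G A B φ}
    (hk : ∀ g, g * k * g⁻¹ ∉ (of : G →* HNNExtension G A B φ).range)
    (hcomm : ∀ g, ∃ m : ℕ, 0 < m ∧ Commute k (g * k ^ m * g⁻¹)) : A = ⊤ ∧ B = ⊤ := by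
  obtain ⟨g₀, l, u, a, hl, hc, hg₀⟩ := exists_conj_eq_cyclically_reduced hk
  have hcomm' : ∀ g, ∃ l' : List (ℤˣ × G), (l' ++ [(u, a)]).IsChain (NoCancel A B) ∧
      (l' ++ [(u, a)]).head? = (l ++ [(u, a)]).head? ∧
      wordProd φ (l ++ [(u, a)]) * (g * wordProd φ (l' ++ [(u, a)]) * g⁻¹) =
        g * wordProd φ (l' ++ [(u, a)]) * g⁻¹ * wordProd φ (l ++ [(u, a)]) := by
    intro g
    obtain ⟨m, hm, h⟩ := hcomm (g₀⁻¹ * g * g₀)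
    obtain ⟨l', h1, h2, h3⟩ := exists_wordProd_eq_pow (φ := φ) hl hc (m - 1)
    refine ⟨l', h1, h2, ?_⟩
    rw [h3, Nat.sub_add_cancel hm, ← hg₀, conj_pow]
    have := h.eq
    calc _ = g₀ * (k * (g₀⁻¹ * g * g₀ * k ^ m * (g₀⁻¹ * g * g₀)⁻¹)) * g₀⁻¹ := by group
      _ = _ := by rw [this]; group
  obtain ⟨⟨v, c⟩, hv⟩ : ∃ y, (l ++ [(u, a)]).head? = some y :=
    Option.isSome_iff_exists.1 (by simp)
  rw [hv] at hc
  simp only [Option.mem_def, Option.some.injEq, forall_eq'] at hc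
  by_cases huv : v = u
  · subst huv
    have h1 : toSubgroup A B (-v) = ⊤ := by
      rw [eq_top_iff]
      intro h _
      obtain ⟨l', hl1, hl2, h3⟩ := hcomm' (of h)
      rw [hv] at hl2
      have := map_fst_eq_of_mul_wordProd_eq (φ := φ) (g := 1) (g' := h)
        (l := l ++ (v, a * h) :: (l' ++ (v, a * h⁻¹) :: []))
        (l' := l' ++ (v, a * h⁻¹) :: (l ++ (v, a) :: []))
        (isChain_noCancel_append hl (isChain_noCancel_append hl1 (by simp) (by simp))
          (by cases l' <;> simp_all))
        (isChain_noCancel_append hl1 hl (by simp [hv]))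
        (by simpa [mul_assoc] using h3)
      simpa using this.2 v (by cases l <;> simp_all)
    have h2 : toSubgroup A B v = ⊤ := by
      rw [eq_top_iff]
      intro h _
      by_contra hh
      obtain ⟨l', hl1, hl2, h3⟩ := hcomm' (of (a⁻¹ * h⁻¹ * a))
      rw [hv] at hl2
      have := map_fst_eq_of_mul_wordProd_eq (φ := φ) (g := 1) (g' := a⁻¹ * h⁻¹ * a)
        (l := l ++ (v, h⁻¹ * a) :: (l' ++ (v, h) :: [(-v, 1)]))
        (l' := l' ++ (v, h * a) :: l)
        (isChain_noCancel_append hl (isChain_noCancel_append hl1 (by simp) (by simp [hh]))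
          (by cases l' <;> simp_all))
        (isChain_noCancel_append hl1 (List.isChain_append.1 hl).1
          (by cases l <;> simp_all))
        (by
          have h4 := congrArg (fun x => x * (of a)⁻¹ * (t ^ (v : ℤ))⁻¹) h3
          simpa [mul_assoc] using h4)
      have := congrArg List.length this.1
      simp at this
      omega
    rcases Int.units_eq_one_or v with rfl | rfl
    · exact ⟨h2, h1⟩
    · exact ⟨by simpa using h1, h2⟩
  · exfalso
    have ha : a ∉ toSubgroup A B u := fun h => huv (hc h).symm
    obtain rfl : v = -u := by
      rcases Int.units_eq_one_or u with rfl | rfl <;>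
      rcases Int.units_eq_one_or v with rfl | rfl <;> simp_all
    obtain ⟨l', hl1, hl2, h3⟩ := hcomm' (t ^ (u : ℤ) * of a * (t ^ (u : ℤ))⁻¹)
    rw [hv] at hl2
    have ha' : a⁻¹ ∉ toSubgroup A B u := by simpa using ha
    have hs : ∀ {b : G} {l'' : List (ℤˣ × G)}, b ∉ toSubgroup A B u →
        l''.IsChain (NoCancel A B) → (∀ y ∈ l''.head?, y.1 = -u) →
        ((u, b) :: (-u, 1) :: l'').IsChain (NoCancel A B) := by
      intro b l'' hb h h'
      refine List.isChain_cons.2 ⟨by simp [NoCancel, hb], List.isChain_cons.2 ⟨?_, h⟩⟩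
      intro y hy _
      exact (h' y hy).symm
    have := map_fst_eq_of_mul_wordProd_eq (φ := φ) (g := 1) (g' := 1)
        (l := l ++ (u, a) :: ((u, a) :: (-u, 1) :: (l' ++ (u, a) :: [(u, a⁻¹), (-u, 1)])))
        (l' := (u, a) :: (-u, 1) :: (l' ++ (u, a) :: (u, a⁻¹) :: (-u, 1) :: (l ++ [(u, a)])))
        (isChain_noCancel_append hl (hs ha (isChain_noCancel_append hl1
          (hs ha' (by simp) (by simp)) (by simp)) (by cases l' <;> simp_all)) (by simp))
        (hs ha (isChain_noCancel_append hl1 (hs ha' hl (by simp [hv])) (by simp))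
          (by cases l' <;> simp_all))
        (by simpa [mul_assoc] using h3)
    have := congrArg List.head? this.1
    cases l <;> simp_all

end HNNExtension

section CyclotomicConjugacy

open Polynomial

theorem aeval_restrict_apply {F V : Type*} [Field F] [AddCommGroup V] [Module F V]
    (f : V →ₗ[F] V) {W : Submodule F V} (h : ∀ x ∈ W, f x ∈ W) (p : F[X]) (x : W) :
    ((aeval (f.restrict h) p x : W) : V) = aeval f p x := by
  induction p using Polynomial.induction_on' with
  | add p q hp hq => simp [hp, hq]
  | monomial n r =>
    have : ∀ n : ℕ, (((f.restrict h) ^ n) x : V) = (f ^ n) x := by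
      intro n
      induction n with
      | zero => simp
      | succ n ih => rw [pow_succ', pow_succ', Module.End.mul_apply, Module.End.mul_apply,
          LinearMap.coe_restrict_apply, ih]
    simp [aeval_monomial, this]

theorem aeval_eq_zero_of_mem_span {F V : Type*} [Field F] [AddCommGroup V] [Module F V]
    {p : F[X]} (f : V →ₗ[F] V) (hf : aeval f p = 0) (q : F[X]) (hq : q ∈ Ideal.span {p}) :
    aeval f q = 0 := by
  obtain ⟨r, rfl⟩ := Ideal.mem_span_singleton'.1 hq
  simp [hf]

/-- A finite-dimensional vector space with an endomorphism killed by an irreducible polynomial is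
determined up to isomorphism by its dimension. -/
theorem exists_intertwining_of_irreducible {F V U : Type*} [Field F] [AddCommGroup V] [Module F V]
    [AddCommGroup U] [Module F U] [FiniteDimensional F V] [FiniteDimensional F U]
    {p : F[X]} (hp : Irreducible p) (f : V →ₗ[F] V) (g : U →ₗ[F] U)
    (hf : aeval f p = 0) (hg : aeval g p = 0)
    (hr : Module.finrank F V = Module.finrank F U) :
    ∃ θ : V ≃ₗ[F] U, ∀ v, θ (f v) = g (θ v) := by
  have : Fact (Irreducible p) := ⟨hp⟩
  let K := AdjoinRoot p
  let a : K →ₐ[F] (V →ₗ[F] V) :=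
    Ideal.Quotient.liftₐ (Ideal.span {p}) (aeval f) (aeval_eq_zero_of_mem_span f hf)
  let b : K →ₐ[F] (U →ₗ[F] U) :=
    Ideal.Quotient.liftₐ (Ideal.span {p}) (aeval g) (aeval_eq_zero_of_mem_span g hg)
  have har : a (AdjoinRoot.root p) = f := by
    change aeval f X = f
    simp
  have hbr : b (AdjoinRoot.root p) = g := by
    change aeval g X = g
    simp
  let _ : Module K V := Module.compHom V a.toRingHom
  let _ : Module K U := Module.compHom U b.toRingHom
  have hsa : ∀ (k : K) (v : V), k • v = a k v := fun _ _ => rfl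
  have hsb : ∀ (k : K) (v : U), k • v = b k v := fun _ _ => rfl
  have : IsScalarTower F K V := ⟨fun r k v => by simp [hsa]⟩
  have : IsScalarTower F K U := ⟨fun r k v => by simp [hsb]⟩
  have : Module.Finite K V := Module.Finite.of_restrictScalars_finite F K V
  have : Module.Finite K U := Module.Finite.of_restrictScalars_finite F K U
  have : Module.Finite F K := (AdjoinRoot.powerBasis hp.ne_zero).finite
  have h1 := Module.finrank_mul_finrank F K V
  have h2 := Module.finrank_mul_finrank F K U
  have h3 : Module.finrank K V = Module.finrank K U := by
    have h0 : 0 < Module.finrank F K := Module.finrank_pos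
    apply Nat.eq_of_mul_eq_mul_left h0
    rw [h1, h2, hr]
  let θ := LinearEquiv.ofFinrankEq (R := K) V U h3
  refine ⟨θ.restrictScalars F, fun v => ?_⟩
  have := θ.map_smul (AdjoinRoot.root p) v
  rwa [hsa, hsb, har, hbr] at this

theorem cyclotomic_dvd_expand_of_coprime {d a : ℕ} (hd : 0 < d) (h : a.Coprime d) :
    cyclotomic d ℚ ∣ expand ℚ a (cyclotomic d ℚ) := by
  have hζ := Complex.isPrimitiveRoot_exp d hd.ne'
  have hζa := hζ.pow_of_coprime a h
  conv_lhs => rw [cyclotomic_eq_minpoly_rat hζ hd]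
  apply minpoly.dvd
  rw [expand_aeval, cyclotomic_eq_minpoly_rat hζa hd, minpoly.aeval]

theorem exists_conj_pow_of_aeval_cyclotomic {W : Type*} [AddCommGroup W] [Module ℚ W]
    [FiniteDimensional ℚ W] (c : W →ₗ[ℚ] W) {d a : ℕ} (hd : 0 < d) (h : a.Coprime d)
    (hc : aeval c (cyclotomic d ℚ) = 0) :
    ∃ θ : W ≃ₗ[ℚ] W, (∀ w, θ (c w) = (c ^ a) (θ w)) ∧ ∀ w, c w = w → θ w = w := by
  rcases eq_or_ne d 1 with rfl | hd1
  · have : c = 1 := by simpa [sub_eq_zero] using hc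
    exact ⟨LinearEquiv.refl _ _, by simp [this], by simp⟩
  · obtain ⟨q, hq⟩ := cyclotomic_dvd_expand_of_coprime hd h
    have hca : aeval (c ^ a) (cyclotomic d ℚ) = 0 := by
      rw [← expand_aeval, hq, map_mul, hc, zero_mul]
    obtain ⟨θ, hθ⟩ := exists_intertwining_of_irreducible (cyclotomic.irreducible_rat hd)
      c (c ^ a) hc hca rfl
    refine ⟨θ, hθ, fun w hw => ?_⟩
    have hdis := disjoint_ker_aeval_of_isCoprime c (cyclotomic.isCoprime_rat hd1)
    have : w = 0 := by
      refine (Submodule.disjoint_def.1 hdis) w (by simp [hc]) ?_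
      simp [hw]
    simp [this]

theorem exists_conj_pow_of_aeval_prod_cyclotomic {a : ℕ} (s : Finset ℕ)
    (hs : ∀ d ∈ s, 0 < d ∧ a.Coprime d) {W : Type*} [AddCommGroup W] [Module ℚ W]
    [FiniteDimensional ℚ W] (c : W →ₗ[ℚ] W)
    (hc : aeval c (∏ d ∈ s, cyclotomic d ℚ) = 0) :
    ∃ θ : W ≃ₗ[ℚ] W, (∀ w, θ (c w) = (c ^ a) (θ w)) ∧ ∀ w, c w = w → θ w = w := by
  classical
  induction s using Finset.induction_on generalizing W with
  | empty =>
    have h0 : ∀ w : W, w = 0 := fun w => by simpa using LinearMap.congr_fun hc w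
    exact ⟨LinearEquiv.refl _ _, fun w => (h0 _).trans (h0 _).symm, by simp⟩
  | insert d s hd ih =>
    rw [Finset.prod_insert hd] at hc
    set p := cyclotomic d ℚ
    set r := ∏ d ∈ s, cyclotomic d ℚ
    have hpr : IsCoprime p r := IsCoprime.prod_right fun e he =>
      cyclotomic.isCoprime_rat fun h => hd (h ▸ he)
    have hcompl : IsCompl (aeval c p).ker (aeval c r).ker := by
      refine ⟨disjoint_ker_aeval_of_isCoprime c hpr, codisjoint_iff.2 ?_⟩
      rw [sup_ker_aeval_eq_ker_aeval_mul_of_coprime c hpr, hc, LinearMap.ker_zero]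
    have hinv : ∀ q : ℚ[X], ∀ x ∈ (aeval c q).ker, c x ∈ (aeval c q).ker := by
      intro q x hx
      rw [LinearMap.mem_ker] at hx ⊢
      have : aeval c q * c = c * aeval c q := by
        simpa only [map_mul, aeval_X] using congrArg (aeval c) (mul_comm q X)
      rw [← Module.End.mul_apply, this, Module.End.mul_apply, hx, map_zero]
    have hker : ∀ q : ℚ[X], aeval (c.restrict (hinv q)) q = 0 := by
      intro q
      ext x
      rw [aeval_restrict_apply]
      exact x.2
    obtain ⟨θ₁, h₁, h₁'⟩ := exists_conj_pow_of_aeval_cyclotomic (c.restrict (hinv p))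
      (hs d (by simp)).1 (hs d (by simp)).2 (hker p)
    obtain ⟨θ₂, h₂, h₂'⟩ := ih (fun e he => hs e (by simp [he])) (c.restrict (hinv r)) (hker r)
    let E := Submodule.prodEquivOfIsCompl _ _ hcompl
    have hEc : ∀ y, c (E y) = E (c.restrict (hinv p) y.1, c.restrict (hinv r) y.2) := by
      intro y
      simp [E]
    have hEca : ∀ (n : ℕ) y, (c ^ n) (E y) =
        E ((c.restrict (hinv p) ^ n) y.1, (c.restrict (hinv r) ^ n) y.2) := by
      intro n
      induction n with
      | zero => simp
      | succ n ihn =>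
        intro y
        simp only [pow_succ', Module.End.mul_apply]
        rw [ihn, hEc]
    refine ⟨E.symm ≪≫ₗ (θ₁.prodCongr θ₂) ≪≫ₗ E, fun w => ?_, fun w hw => ?_⟩
    · obtain ⟨y, rfl⟩ := E.surjective w
      simp only [LinearEquiv.trans_apply, LinearEquiv.symm_apply_apply, hEc, hEca,
        LinearEquiv.prodCongr_apply, h₁, h₂]
    · obtain ⟨y, rfl⟩ := E.surjective w
      rw [hEc, E.injective.eq_iff] at hw
      simp only [LinearEquiv.trans_apply, LinearEquiv.symm_apply_apply,
        LinearEquiv.prodCongr_apply]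
      rw [h₁' _ (congrArg Prod.fst hw), h₂' _ (congrArg Prod.snd hw)]

/-- A rational operator `c` of finite order `m` is conjugate to `c ^ a` for every `a` prime to `m`,
by an operator fixing the fixed vectors of `c`. -/
theorem exists_conj_pow_of_pow_eq_one {W : Type*} [AddCommGroup W] [Module ℚ W]
    [FiniteDimensional ℚ W] {c : W →ₗ[ℚ] W} {m a : ℕ} (hm : 0 < m) (hcm : c ^ m = 1)
    (h : a.Coprime m) :
    ∃ θ : W ≃ₗ[ℚ] W, (∀ w, θ (c w) = (c ^ a) (θ w)) ∧ ∀ w, c w = w → θ w = w := by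
  refine exists_conj_pow_of_aeval_prod_cyclotomic m.divisors (fun d hd => ?_) c ?_
  · exact ⟨Nat.pos_of_mem_divisors hd, h.coprime_dvd_right (Nat.dvd_of_mem_divisors hd)⟩
  · rw [prod_cyclotomic_eq_X_pow_sub_one hm]
    simp [hcm]

/-- Two rational operators of finite order which are powers of each other are conjugate, by an
operator fixing their common fixed vectors. -/
theorem exists_conj_zpow_of_pow_eq_one {W : Type*} [AddCommGroup W] [Module ℚ W]
    [FiniteDimensional ℚ W] {c d : W ≃ₗ[ℚ] W} {q : ℕ} (hq : 0 < q) (hcq : c ^ q = 1)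
    {α β : ℤ} (hd : d = c ^ α) (hc : c = d ^ β) :
    ∃ θ : W ≃ₗ[ℚ] W, (∀ w, θ (c w) = d (θ w)) ∧ ∀ w, c w = w → θ w = w := by
  have hfin : IsOfFinOrder c := isOfFinOrder_iff_pow_eq_one.2 ⟨q, hq, hcq⟩
  have hm := hfin.orderOf_pos
  set m := orderOf c
  obtain ⟨a, ha⟩ : ∃ a : ℕ, (a : ℤ) = α % m := ⟨(α % m).toNat, by
    rw [Int.toNat_of_nonneg (Int.emod_nonneg _ (by exact_mod_cast hm.ne'))]⟩
  have hda : d = c ^ a := by rw [hd, ← zpow_mod_orderOf, ← ha, zpow_natCast]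
  have hcop : a.Coprime m := by
    have h1 : c ^ ((a : ℤ) * β - 1) = 1 := by
      rw [_root_.zpow_sub, _root_.zpow_mul, zpow_natCast, ← hda, ← hc, zpow_one, mul_inv_cancel]
    rw [← orderOf_dvd_iff_zpow_eq_one] at h1
    obtain ⟨r, hr⟩ := h1
    rw [← Nat.isCoprime_iff_coprime]
    exact ⟨β, -r, by linarith⟩
  have hpow : ∀ n : ℕ, ((c : W →ₗ[ℚ] W) ^ n) = ((c ^ n : W ≃ₗ[ℚ] W) : W →ₗ[ℚ] W) := by
    intro n
    induction n with
    | zero => rfl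
    | succ n ih => rw [pow_succ, pow_succ, ih]; rfl
  obtain ⟨θ, h1, h2⟩ := exists_conj_pow_of_pow_eq_one (c := (c : W →ₗ[ℚ] W)) hm
    (by rw [hpow, pow_orderOf_eq_one]; rfl) hcop
  refine ⟨θ, fun w => ?_, h2⟩
  have := h1 w
  rw [hpow, ← hda] at this
  exact this

end CyclotomicConjugacy

section LinearEquivPowers

variable {F V U : Type*} [Field F] [AddCommGroup V] [Module F V] [AddCommGroup U] [Module F U]

theorem LinearEquiv.semiconj_zpow {i : V → U} {f : V ≃ₗ[F] V} {g : U ≃ₗ[F] U}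
    (h : ∀ v, i (f v) = g (i v)) (n : ℤ) (v : V) : i ((f ^ n) v) = (g ^ n) (i v) := by
  induction n generalizing v with
  | zero => rfl
  | succ n ih => rw [_root_.zpow_add_one, _root_.zpow_add_one, LinearEquiv.mul_apply, ih, h]; rfl
  | pred n ih =>
    rw [_root_.zpow_sub_one, _root_.zpow_sub_one, LinearEquiv.mul_apply, ih, LinearEquiv.mul_apply]
    congr 1
    apply g.injective
    rw [← h]
    exact (congrArg i (f.apply_symm_apply v)).trans (g.apply_symm_apply (i v)).symm

theorem LinearEquiv.pow_succ_apply' (f : V ≃ₗ[F] V) (n : ℕ) (v : V) :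
    (f ^ (n + 1)) v = f ((f ^ n) v) := by
  rw [pow_succ']; rfl

/-- The restriction of a linear automorphism to the kernel of an invariant functional. -/
def restrictKer (ε : V →ₗ[F] F) (f : V ≃ₗ[F] V) (hf : ∀ v, ε (f v) = ε v) :
    ε.ker ≃ₗ[F] ε.ker :=
  LinearEquiv.ofLinearMap
    ((f : V →ₗ[F] V).restrict fun v hv => by simpa [hf] using hv)
    ((f.symm : V →ₗ[F] V).restrict fun v hv => by
      rw [LinearMap.mem_ker] at hv ⊢
      rw [← hf]; simpa using hv)
    (by ext; simp) (by ext; simp)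

@[simp]
theorem coe_restrictKer (ε : V →ₗ[F] F) (f : V ≃ₗ[F] V) (hf : ∀ v, ε (f v) = ε v) (w : ε.ker) :
    (restrictKer ε f hf w : V) = f w := rfl

theorem exists_eq_add_of_pow_apply [CharZero F] (ε : V →ₗ[F] F) (f : V ≃ₗ[F] V)
    (hf : ∀ v, ε (f v) = ε v) (q : ℕ) (hq : 0 < q) (x : V) :
    ∃ v, ε v = ε x ∧ f v = v + (q : F)⁻¹ • ((f ^ q) x - x) := by
  have hq0 : (q : F) ≠ 0 := by exact_mod_cast hq.ne'
  have hε : ∀ i : ℕ, ε ((f ^ i) x) = ε x := by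
    intro i
    induction i with
    | zero => rfl
    | succ i ih => rw [LinearEquiv.pow_succ_apply', hf, ih]
  refine ⟨(q : F)⁻¹ • ∑ i ∈ Finset.range q, (f ^ i) x, ?_, ?_⟩
  · simp [hε, hq0]
  · rw [map_smul, map_sum, ← smul_add]
    congr 1
    simp_rw [← LinearEquiv.pow_succ_apply']
    have := Finset.sum_range_sub (fun i => (f ^ i) x) q
    rw [Finset.sum_sub_distrib, sub_eq_iff_eq_add] at this
    rw [this, pow_zero, add_comm]
    rfl

end LinearEquivPowers

/-- Two operators preserving a functional `ε` and acting on its kernel by operators of finite order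
that are powers of each other are conjugate, provided the obstructions to splitting off the
kernel are opposite. -/
theorem exists_conj_of_restrictKer {V : Type*} [AddCommGroup V] [Module ℚ V]
    [FiniteDimensional ℚ V] {f g : V ≃ₗ[ℚ] V} {ε : V →ₗ[ℚ] ℚ} {x : V} {q : ℕ} (hq : 0 < q)
    (hx : ε x = q) (hf : ∀ v, ε (f v) = ε v) (hg : ∀ v, ε (g v) = ε v)
    (hfq : ∀ w, ε w = 0 → (f ^ q) w = w) {α β : ℤ}
    (hα : ∀ w, ε w = 0 → g w = (f ^ α) w) (hβ : ∀ w, ε w = 0 → f w = (g ^ β) w)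
    (hfg : (g ^ q) x - x = -((f ^ q) x - x)) :
    ∃ Θ : V ≃ₗ[ℚ] V, ∀ v, Θ (f v) = g (Θ v) := by
  have hq0 : (q : ℚ) ≠ 0 := by exact_mod_cast hq.ne'
  set c₀ := (f ^ q) x - x with hc₀
  obtain ⟨v, hv, hfv⟩ := exists_eq_add_of_pow_apply ε f hf q hq x
  obtain ⟨u, hu, hgu⟩ := exists_eq_add_of_pow_apply ε g hg q hq x
  rw [← hc₀] at hfv
  rw [hfg] at hgu
  rw [hx] at hv hu
  have hcomm : ∀ y, (f ^ q) (f y) = f ((f ^ q) y) := fun y => by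
    rw [← LinearEquiv.pow_succ_apply', pow_succ]; rfl
  have hfc₀ : f c₀ = c₀ := by
    have h1 := hfq (f x - x) (by simp [hf])
    rw [map_sub, hcomm] at h1
    rw [hc₀, map_sub]
    calc f ((f ^ q) x) - f x = (f ((f ^ q) x) - (f ^ q) x) + (f ^ q) x - f x := by abel
      _ = _ := by rw [h1]; abel
  have hεc₀ : ε c₀ = 0 := by
    have h1 := congrArg ε hfv
    rw [hf, map_add, left_eq_add, map_smul, smul_eq_mul] at h1
    simpa [hq0] using h1
  let c := restrictKer ε f hf
  let d := restrictKer ε g hg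
  have hc : ∀ (n : ℤ) (w : ε.ker), ((c ^ n) w : V) = (f ^ n) w := fun n w =>
    LinearEquiv.semiconj_zpow (i := (Subtype.val : ε.ker → V)) (f := c) (g := f) (fun _ => rfl) n w
  have hd : ∀ (n : ℤ) (w : ε.ker), ((d ^ n) w : V) = (g ^ n) w := fun n w =>
    LinearEquiv.semiconj_zpow (i := (Subtype.val : ε.ker → V)) (f := d) (g := g) (fun _ => rfl) n w
  obtain ⟨θ, hθ, hθ'⟩ := exists_conj_zpow_of_pow_eq_one (c := c) (d := d) hq
    (by
      ext w
      have := hc q w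
      rw [zpow_natCast, zpow_natCast, hfq w w.2] at this
      simpa using this)
    (α := α) (β := β) (by ext w; rw [hc]; exact hα w w.2) (by ext w; rw [hd]; exact hβ w w.2)
  have hθc₀ : θ ⟨c₀, hεc₀⟩ = ⟨c₀, hεc₀⟩ := hθ' _ (Subtype.ext hfc₀)
  let π : V →ₗ[ℚ] ε.ker :=
    (LinearMap.id - ((q : ℚ)⁻¹ • ε).smulRight v).codRestrict ε.ker (fun y => by
      simp [hv]; field_simp; ring)
  have hπ : ∀ y, (π y : V) = y - ((q : ℚ)⁻¹ * ε y) • v := fun y => by simp [π]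
  let Θ : V →ₗ[ℚ] V := ε.ker.subtype ∘ₗ (θ : ε.ker →ₗ[ℚ] ε.ker) ∘ₗ π -
    ((q : ℚ)⁻¹ • ε).smulRight u
  have hΘ : ∀ y, Θ y = θ (π y) - ((q : ℚ)⁻¹ * ε y) • u := fun y => by simp [Θ]
  have hker : ∀ w : ε.ker, ε (w : V) = 0 := fun w => w.2
  have hinj : Function.Injective Θ := by
    rw [injective_iff_map_eq_zero]
    intro y hy
    have h1 : ε y = 0 := by
      have := congrArg ε hy
      rw [hΘ, map_sub, hker, map_smul, hu] at this
      simpa [hq0] using this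
    rw [hΘ, h1, mul_zero, zero_smul, sub_zero, ZeroMemClass.coe_eq_zero,
      LinearEquiv.map_eq_zero_iff] at hy
    have := hπ y
    rw [hy, h1] at this
    simpa using this.symm
  refine ⟨LinearEquiv.ofInjectiveEndo Θ hinj, fun y => ?_⟩
  change Θ (f y) = g (Θ y)
  have h1 : π (f y) = c (π y) + ((q : ℚ)⁻¹ * ε y * (q : ℚ)⁻¹) • ⟨c₀, hεc₀⟩ := by
    ext
    simp only [hπ, Submodule.coe_add, Submodule.coe_smul, hf, c, coe_restrictKer, map_sub,
      map_smul, hfv, smul_add, smul_smul]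
    abel
  rw [hΘ, hΘ, h1, map_add, map_smul, hθ, hθc₀, hf, map_sub, map_smul, hgu]
  simp only [Submodule.coe_add, Submodule.coe_smul, d, coe_restrictKer, smul_add, smul_smul,
    smul_neg]
  abel

section RationalExtension

variable {n m : ℕ}

@[simp]
theorem ZtoQ_apply (w : Fin n → ℤ) (i : Fin n) : ZtoQ n w i = w i := rfl

theorem ZtoQ_injective : Function.Injective (ZtoQ n) := fun v w h => by
  ext i
  simpa using congrFun h i

theorem exists_nsmul_eq_ZtoQ (v : Fin n → ℚ) :
    ∃ N : ℕ, 0 < N ∧ ∃ w, N • v = ZtoQ n w := by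
  refine ⟨∏ i, (v i).den, Finset.prod_pos fun i _ => (v i).den_pos,
    fun i => (∏ j ∈ Finset.univ.erase i, ((v j).den : ℤ)) * (v i).num, ?_⟩
  ext i
  rw [ZtoQ_apply, ← Finset.mul_prod_erase _ _ (Finset.mem_univ i)]
  have := Rat.mul_den_eq_num (v i)
  simp only [Pi.smul_apply, nsmul_eq_mul]
  push_cast
  rw [← this]
  ring

theorem eq_of_nsmul_eq {V : Type*} [AddCommGroup V] [Module ℚ V] {N : ℕ} (hN : 0 < N) {v w : V}
    (h : N • v = N • w) : v = w := by
  rw [← Nat.cast_smul_eq_nsmul ℚ, ← Nat.cast_smul_eq_nsmul ℚ] at h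
  exact smul_right_injective V (by exact_mod_cast hN.ne') h

theorem linearMap_ext_ZtoQ {V : Type*} [AddCommGroup V] [Module ℚ V]
    {S T : (Fin n → ℚ) →ₗ[ℚ] V}
    (h : ∀ w, ∃ N : ℕ, 0 < N ∧ S (ZtoQ n (N • w)) = T (ZtoQ n (N • w))) : S = T := by
  ext v
  obtain ⟨N, hN, w, hw⟩ := exists_nsmul_eq_ZtoQ (LinearMap.single ℚ (fun _ : Fin n => ℚ) v 1)
  obtain ⟨M, hM, h'⟩ := h w
  rw [map_nsmul, ← hw] at h'
  simp only [map_nsmul] at h'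
  exact eq_of_nsmul_eq hN (eq_of_nsmul_eq hM h')

theorem exists_linearMap_extending (φ : (Fin n → ℤ) →+ ℤ) :
    ∃ ε : (Fin n → ℚ) →ₗ[ℚ] ℚ, ∀ w, ε (ZtoQ n w) = φ w := by
  refine ⟨∑ i, (φ (Pi.single i 1) : ℚ) • LinearMap.proj i, fun w => ?_⟩
  have h : φ w = ∑ i, w i • φ (Pi.single i 1) := by
    conv_lhs => rw [pi_eq_sum_univ' w]
    simp only [map_sum, map_zsmul]
  simp [h, mul_comm]

theorem exists_linearMap_of_rel (R : AddSubgroup ((Fin n → ℤ) × (Fin m → ℤ)))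
    (h₁ : ∀ w, (0, w) ∈ R → w = 0) (h₂ : ∀ v, ∃ N : ℕ, 0 < N ∧ ∃ w, (N • v, w) ∈ R) :
    ∃ T : (Fin n → ℚ) →ₗ[ℚ] (Fin m → ℚ), ∀ v w, (v, w) ∈ R → T (ZtoQ n v) = ZtoQ m w := by
  choose N hN u hu using fun i : Fin n => h₂ (Pi.single i 1)
  let P := ∏ i, N i
  have hP : 0 < P := Finset.prod_pos fun i _ => hN i
  choose M hM using fun i : Fin n => Finset.dvd_prod_of_mem N (Finset.mem_univ i)
  have hu' : ∀ i, ((P : ℤ) • (Pi.single i 1 : Fin n → ℤ), M i • u i) ∈ R := fun i => by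
    have := R.nsmul_mem (hu i) (M i)
    rwa [Prod.smul_mk, smul_smul, mul_comm (M i), ← hM i, ← natCast_zsmul] at this
  refine ⟨(Pi.basisFun ℚ (Fin n)).constr ℚ fun i => (P : ℚ)⁻¹ • ZtoQ m (M i • u i),
    fun v w hvw => ?_⟩
  have hv : (P : ℤ) • v = ∑ i, v i • (P : ℤ) • (Pi.single i 1 : Fin n → ℤ) := by
    ext j
    simp [Finset.sum_apply, Pi.single_apply, mul_comm]
  have h : (P : ℤ) • w = ∑ i, v i • M i • u i := by
    rw [← sub_eq_zero]
    apply h₁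
    have := R.sub_mem (R.zsmul_mem hvw P) (R.sum_mem fun i (_ : i ∈ Finset.univ) =>
      R.zsmul_mem (hu' i) (v i))
    convert! this using 1
    ext1
    · simp [Prod.fst_sum, hv]
    · simp [Prod.snd_sum]
  apply eq_of_nsmul_eq hP
  rw [← map_nsmul (ZtoQ m), ← natCast_zsmul w, h, Module.Basis.constr_apply_fintype, Finset.smul_sum, map_sum]
  refine Finset.sum_congr rfl fun i _ => ?_
  have hP0 : (P : ℚ) ≠ 0 := by exact_mod_cast hP.ne'
  ext j
  simp
  field_simp

/-- A correspondence between lattices which is injective and defined up to multiples in both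
directions extends to an isomorphism of rational vector spaces. -/
theorem exists_linearEquiv_of_rel (R : AddSubgroup ((Fin n → ℤ) × (Fin m → ℤ)))
    (h₁ : ∀ w, (0, w) ∈ R → w = 0) (h₁' : ∀ v, (v, 0) ∈ R → v = 0)
    (h₂ : ∀ v, ∃ N : ℕ, 0 < N ∧ ∃ w, (N • v, w) ∈ R)
    (h₂' : ∀ w, ∃ N : ℕ, 0 < N ∧ ∃ v, (v, N • w) ∈ R) :
    ∃ T : (Fin n → ℚ) ≃ₗ[ℚ] (Fin m → ℚ), ∀ v w, (v, w) ∈ R → T (ZtoQ n v) = ZtoQ m w := by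
  obtain ⟨T, hT⟩ := exists_linearMap_of_rel R h₁ h₂
  obtain ⟨T', hT'⟩ := exists_linearMap_of_rel (R.map (AddEquiv.prodComm.toAddMonoidHom))
    (by simpa using h₁') (by simpa using h₂')
  have hT'' : ∀ v w, (v, w) ∈ R → T' (ZtoQ m w) = ZtoQ n v := fun v w h => hT' _ _ (by simpa using h)
  refine ⟨LinearEquiv.ofLinearMap T T' ?_ ?_, hT⟩
  · refine linearMap_ext_ZtoQ fun w => ?_
    obtain ⟨N, hN, v, h⟩ := h₂' w
    exact ⟨N, hN, by rw [LinearMap.comp_apply, hT'' _ _ h, hT _ _ h, LinearMap.id_apply]⟩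
  · refine linearMap_ext_ZtoQ fun v => ?_
    obtain ⟨N, hN, w, h⟩ := h₂ v
    exact ⟨N, hN, by rw [LinearMap.comp_apply, hT _ _ h, hT'' _ _ h, LinearMap.id_apply]⟩

end RationalExtension

/-- The features of a Leary–Minasyan group which determine the conjugacy class of the matrix: the
base group `ι`, the stable letter `t` and its exponent `e`, and the conjugation action on the
base group, which is given by the linear map `f`. -/
structure LMData (G : Type*) [Group G] (n : ℕ) (f : (Fin n → ℚ) ≃ₗ[ℚ] (Fin n → ℚ)) where
  /-- the base group -/
  ι : Multiplicative (Fin n → ℤ) →* G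
  /-- the exponent of the stable letter -/
  e : G →* Multiplicative ℤ
  /-- the stable letter -/
  t : G
  ι_injective : Function.Injective ι
  e_ι : ∀ v, e (ι v) = 1
  e_t : e t = Multiplicative.ofAdd 1
  conj_eq : ∀ g v w, g * ι (.ofAdd v) * g⁻¹ = ι (.ofAdd w) →
    ZtoQ n w = (f ^ (e g).toAdd) (ZtoQ n v)
  exists_conj_pow_mem : ∀ g v, ∃ N : ℕ, 0 < N ∧ g * ι v ^ N * g⁻¹ ∈ ι.range
  ker_e_le : ∀ S : Subgroup G, S.Normal → ι.range ≤ S → e.ker ≤ S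
  ker_e_le_range : ∀ k, (∀ g, ∃ m : ℕ, 0 < m ∧ Commute k (g * k ^ m * g⁻¹)) →
    (∃ N : ℕ, 0 < N ∧ k ^ N ∈ ι.range) ∨ e.ker ≤ ι.range

namespace LMData

open Multiplicative

variable {G : Type*} [Group G] {n m : ℕ} {f : (Fin n → ℚ) ≃ₗ[ℚ] (Fin n → ℚ)}
  {f' : (Fin m → ℚ) ≃ₗ[ℚ] (Fin m → ℚ)} (D : LMData G n f) (D' : LMData G m f')

theorem ι_nsmul (N : ℕ) (v : Fin n → ℤ) : D.ι (ofAdd (N • v)) = D.ι (ofAdd v) ^ N := by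
  rw [ofAdd_nsmul, map_pow]

theorem mem_ker_of_pow_mem {N : ℕ} (hN : 0 < N) {g : G} (h : g ^ N ∈ D.ι.range) :
    g ∈ D.e.ker := by
  obtain ⟨v, hv⟩ := h
  have := congrArg toAdd (congrArg D.e hv)
  rw [D.e_ι, map_pow, toAdd_pow] at this
  rw [MonoidHom.mem_ker]
  apply toAdd.injective
  simpa [hN.ne', eq_comm] using this

theorem ker_le_ker (h : ∀ v, ∃ N : ℕ, 0 < N ∧ D.ι v ^ N ∈ D'.ι.range) : D.e.ker ≤ D'.e.ker := by
  apply D.ker_e_le _ inferInstance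
  rintro _ ⟨v, rfl⟩
  obtain ⟨N, hN, h⟩ := h v
  exact D'.mem_ker_of_pow_mem hN h

theorem toAdd_e_eq_mul (h : D.e.ker ≤ D'.e.ker) (g : G) :
    (D'.e g).toAdd = (D.e g).toAdd * (D'.e D.t).toAdd := by
  have : g * D.t ^ (-(D.e g).toAdd) ∈ D'.e.ker := h (by
    rw [MonoidHom.mem_ker]
    apply toAdd.injective
    simp [D.e_t])
  rw [MonoidHom.mem_ker] at this
  have := congrArg toAdd this
  simp at this
  linarith

/-- The pairs of vectors which represent the same element of `G`. -/
def rel : AddSubgroup ((Fin n → ℤ) × (Fin m → ℤ)) where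
  carrier := {p | D.ι (ofAdd p.1) = D'.ι (ofAdd p.2)}
  add_mem' := by
    intro a b ha hb
    simp_all [ofAdd_add]
  zero_mem' := by simp
  neg_mem' := by
    intro a ha
    simp_all

@[simp]
theorem mem_rel {v : Fin n → ℤ} {w : Fin m → ℤ} :
    (v, w) ∈ D.rel D' ↔ D.ι (ofAdd v) = D'.ι (ofAdd w) := Iff.rfl

theorem eq_zero_of_ι_eq_one {v : Fin n → ℤ} (h : D.ι (ofAdd v) = 1) : v = 0 :=
  ofAdd.injective (D.ι_injective (h.trans (map_one D.ι).symm))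

theorem exists_conj_of_commensurable
    (h : ∀ v, ∃ N : ℕ, 0 < N ∧ D.ι v ^ N ∈ D'.ι.range)
    (h' : ∀ v, ∃ N : ℕ, 0 < N ∧ D'.ι v ^ N ∈ D.ι.range) :
    ∃ T : (Fin n → ℚ) ≃ₗ[ℚ] (Fin m → ℚ),
      (∀ v, T (f v) = f' (T v)) ∨ (∀ v, T (f v) = f'.symm (T v)) := by
  have hrel : ∀ v : Fin n → ℤ, ∃ N : ℕ, 0 < N ∧ ∃ w, (N • v, w) ∈ D.rel D' := fun v => by
    obtain ⟨N, hN, w, hw⟩ := h (ofAdd v)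
    exact ⟨N, hN, toAdd w, by rw [mem_rel, ι_nsmul, ← hw]; rfl⟩
  obtain ⟨T, hT⟩ := exists_linearEquiv_of_rel (D.rel D')
    (fun w hw => D'.eq_zero_of_ι_eq_one (by simpa [eq_comm] using hw))
    (fun v hv => D.eq_zero_of_ι_eq_one (by simpa using hv)) hrel (fun w => by
      obtain ⟨N, hN, v, hv⟩ := h' (ofAdd w)
      exact ⟨N, hN, toAdd v, by rw [mem_rel, ι_nsmul, ← hv]; rfl⟩)
  have hconj : (T : (Fin n → ℚ) →ₗ[ℚ] (Fin m → ℚ)) ∘ₗ f =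
      ((f' ^ (D'.e D.t).toAdd : (Fin m → ℚ) ≃ₗ[ℚ] (Fin m → ℚ)) :
        (Fin m → ℚ) →ₗ[ℚ] (Fin m → ℚ)) ∘ₗ T.toLinearMap := by
    refine linearMap_ext_ZtoQ fun w => ?_
    obtain ⟨N₁, hN₁, w₁, hw₁⟩ := D.exists_conj_pow_mem D.t (ofAdd w)
    obtain ⟨N₂, hN₂, u₁, hu₁⟩ := hrel (toAdd w₁)
    obtain ⟨N₃, hN₃, u, hu⟩ := hrel w
    have hu₁' := (D.rel D').nsmul_mem hu₁ N₃
    have hu' := (D.rel D').nsmul_mem hu (N₁ * N₂)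
    rw [Prod.smul_mk] at hu₁' hu'
    have hN : (N₁ * N₂) • N₃ • w = N₁ • (N₂ * N₃) • w := by simp only [smul_smul, mul_assoc]
    have key : D.t * D.ι (ofAdd ((N₁ * N₂) • N₃ • w)) * D.t⁻¹ =
        D.ι (ofAdd (N₃ • N₂ • toAdd w₁)) := by
      rw [hN, smul_comm N₁, smul_smul N₃, mul_comm N₃, ι_nsmul, ι_nsmul, ι_nsmul, ofAdd_toAdd,
        hw₁, conj_pow]
    have h1 := D.conj_eq _ _ _ key
    rw [D.e_t, toAdd_ofAdd, zpow_one] at h1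
    have h2 := D'.conj_eq D.t ((N₁ * N₂) • u) (N₃ • u₁) (by
      rw [← (mem_rel D D').1 hu₁', ← (mem_rel D D').1 hu', key])
    refine ⟨N₁ * N₂ * N₃, by positivity, ?_⟩
    rw [mul_smul]
    simp only [LinearMap.comp_apply, LinearEquiv.coe_coe]
    rw [← h1, hT _ _ hu₁', hT _ _ hu', h2]
  refine ⟨T, ?_⟩
  have hunit : (D.e D'.t).toAdd * (D'.e D.t).toAdd = 1 := by
    rw [← D.toAdd_e_eq_mul D' (D.ker_le_ker D' h), D'.e_t, toAdd_ofAdd]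
  rcases Int.eq_one_or_neg_one_of_mul_eq_one' hunit with ⟨-, h1⟩ | ⟨-, h1⟩
  · left
    intro v
    have := LinearMap.congr_fun hconj v
    rwa [h1, zpow_one] at this
  · right
    intro v
    have := LinearMap.congr_fun hconj v
    rwa [h1, _root_.zpow_neg, zpow_one] at this

theorem ker_e_le_range_of_pow_notMem {v : Multiplicative (Fin m → ℤ)}
    (hv : ∀ N : ℕ, 0 < N → D'.ι v ^ N ∉ D.ι.range) : D.e.ker ≤ D.ι.range := by
  refine (D.ker_e_le_range (D'.ι v) fun g => ?_).resolve_left fun ⟨N, hN, h⟩ => hv N hN h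
  obtain ⟨N, hN, w, hw⟩ := D'.exists_conj_pow_mem g v
  exact ⟨N, hN, by rw [← hw]; exact (Commute.all v w).map D'.ι⟩

theorem apply_eq_of_apply_ZtoQ_eq (φ : G →* Multiplicative ℤ) {ε : (Fin n → ℚ) →ₗ[ℚ] ℚ}
    (hε : ∀ w, ε (ZtoQ n w) = (φ (D.ι (ofAdd w))).toAdd) (v : Fin n → ℚ) : ε (f v) = ε v := by
  suffices ε ∘ₗ f.toLinearMap = ε from LinearMap.congr_fun this v
  refine linearMap_ext_ZtoQ fun w => ?_
  obtain ⟨N, hN, u, hu⟩ := D.exists_conj_pow_mem D.t (ofAdd w)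
  refine ⟨N, hN, ?_⟩
  have h := D.conj_eq D.t (N • w) (toAdd u) (by rw [ι_nsmul, ofAdd_toAdd, hu])
  rw [D.e_t, toAdd_ofAdd, zpow_one] at h
  rw [LinearMap.comp_apply, LinearEquiv.coe_coe, ← h, hε, hε, ofAdd_toAdd, hu, ι_nsmul]
  simp

section Normal

variable {D D'} {x : Fin n → ℤ} {z : Fin m → ℤ} {q : ℕ}

theorem add_zsmul_eq_zero_of_mem_rel (hq : 0 < q) (hx : (D'.e (D.ι (ofAdd x))).toAdd = q)
    {a : Fin n → ℤ} {b : Fin m → ℤ} (hab : D.ι (ofAdd a) = D'.ι (ofAdd b)) {j : ℤ}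
    (h : a + j • x = 0) : b + j • z = 0 := by
  have h1 := congrArg (fun v => (D'.e (D.ι (ofAdd v))).toAdd) h
  simp only [ofAdd_add, ofAdd_zsmul, map_mul, map_zpow, toAdd_mul, toAdd_zpow, hx, hab, D'.e_ι,
    toAdd_one, ofAdd_zero, map_one, zero_add, smul_eq_mul, mul_eq_zero] at h1
  have hj : j = 0 := h1.resolve_right (by exact_mod_cast hq.ne')
  subst hj
  rw [zero_smul, add_zero] at h ⊢
  subst h
  exact D'.eq_zero_of_ι_eq_one (by rw [← hab, ofAdd_zero, map_one])

theorem exists_nsmul_eq_add (hD' : D'.e.ker ≤ D'.ι.range)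
    (hx : (D'.e (D.ι (ofAdd x))).toAdd = q) (v : Fin n → ℤ) :
    ∃ a b, D.ι (ofAdd a) = D'.ι (ofAdd b) ∧
      q • v = a + (D'.e (D.ι (ofAdd v))).toAdd • x := by
  obtain ⟨b, hb⟩ := @hD' (D.ι (ofAdd (q • v - (D'.e (D.ι (ofAdd v))).toAdd • x))) (by
    rw [MonoidHom.mem_ker]
    apply toAdd.injective
    rw [ofAdd_sub, ofAdd_nsmul, ofAdd_zsmul, map_div, map_pow, map_zpow, map_div, map_pow, map_zpow,
      toAdd_div, toAdd_pow, toAdd_zpow, hx, toAdd_one, nsmul_eq_mul, smul_eq_mul, mul_comm, sub_self])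
  exact ⟨_, toAdd b, hb.symm, by abel⟩

theorem exists_linearEquiv_of_ker_le (hD : D.e.ker ≤ D.ι.range) (hD' : D'.e.ker ≤ D'.ι.range)
    (hq : 0 < q) (hx : (D'.e (D.ι (ofAdd x))).toAdd = q)
    (hz : (D.e (D'.ι (ofAdd z))).toAdd = q) :
    ∃ T : (Fin n → ℚ) ≃ₗ[ℚ] (Fin m → ℚ), T (ZtoQ n x) = ZtoQ m z ∧
      ∀ v w, D.ι (ofAdd v) = D'.ι (ofAdd w) → T (ZtoQ n v) = ZtoQ m w := by
  have hmem : ∀ v w, (v, w) ∈ D.rel D' ⊔ AddSubgroup.zmultiples (x, z) ↔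
      ∃ a b, D.ι (ofAdd a) = D'.ι (ofAdd b) ∧ ∃ j : ℤ, a + j • x = v ∧ b + j • z = w := by
    simp [AddSubgroup.mem_sup, AddSubgroup.mem_zmultiples_iff]
  obtain ⟨T, hT⟩ := exists_linearEquiv_of_rel (D.rel D' ⊔ AddSubgroup.zmultiples (x, z))
    (fun w hw => by
      obtain ⟨a, b, hab, j, h, rfl⟩ := (hmem _ _).1 hw
      exact add_zsmul_eq_zero_of_mem_rel hq hx hab h)
    (fun v hv => by
      obtain ⟨a, b, hab, j, rfl, h⟩ := (hmem _ _).1 hv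
      exact add_zsmul_eq_zero_of_mem_rel hq hz hab.symm h)
    (fun v => by
      obtain ⟨a, b, hab, h⟩ := exists_nsmul_eq_add hD' hx v
      exact ⟨q, hq, _, (hmem _ _).2 ⟨a, b, hab, _, h.symm, rfl⟩⟩)
    (fun w => by
      obtain ⟨b, a, hab, h⟩ := exists_nsmul_eq_add hD hz w
      exact ⟨q, hq, _, (hmem _ _).2 ⟨a, b, hab.symm, _, rfl, h.symm⟩⟩)
  refine ⟨T, hT _ _ ((hmem _ _).2 ⟨0, 0, by simp, 1, by simp, by simp⟩), fun v w h => ?_⟩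
  exact hT _ _ ((hmem _ _).2 ⟨v, w, h, 0, by simp, by simp⟩)

theorem exists_conj_eq (hD : D.e.ker ≤ D.ι.range) (g : G) (v : Fin n → ℤ) :
    ∃ w, g * D.ι (ofAdd v) * g⁻¹ = D.ι (ofAdd w) := by
  obtain ⟨w, hw⟩ := @hD (g * D.ι (ofAdd v) * g⁻¹) (by simp [MonoidHom.mem_ker, D.e_ι])
  exact ⟨toAdd w, hw.symm⟩

theorem apply_zpow_eq (hD : D.e.ker ≤ D.ι.range) (hD' : D'.e.ker ≤ D'.ι.range)
    {T : (Fin n → ℚ) ≃ₗ[ℚ] (Fin m → ℚ)}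
    (hT : ∀ v w, D.ι (ofAdd v) = D'.ι (ofAdd w) → T (ZtoQ n v) = ZtoQ m w)
    {ε : (Fin n → ℚ) →ₗ[ℚ] ℚ} (hε : ∀ w, ε (ZtoQ n w) = (D'.e (D.ι (ofAdd w))).toAdd)
    (g : G) (v : Fin n → ℚ) (hv : ε v = 0) :
    T ((f ^ (D.e g).toAdd) v) = (f' ^ (D'.e g).toAdd) (T v) := by
  obtain ⟨N, hN, w, hw⟩ := exists_nsmul_eq_ZtoQ v
  obtain ⟨b, hb⟩ := @hD' (D.ι (ofAdd w)) (by
    rw [MonoidHom.mem_ker]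
    apply toAdd.injective
    have := hε w
    rw [← hw, map_nsmul, hv, nsmul_zero] at this
    exact_mod_cast this.symm)
  obtain ⟨a, ha⟩ := exists_conj_eq hD g w
  obtain ⟨c, hc⟩ := exists_conj_eq hD' g (toAdd b)
  rw [ofAdd_toAdd, hb] at hc
  apply eq_of_nsmul_eq hN
  rw [← map_nsmul, ← map_nsmul, ← map_nsmul, ← map_nsmul, hw, ← D.conj_eq _ _ _ ha,
    hT _ _ hb.symm, hT _ _ (ha.symm.trans hc), D'.conj_eq g (toAdd b) c (by
      rw [ofAdd_toAdd, hb, hc])]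
  rfl

theorem exists_conj_of_ker_le (hD : D.e.ker ≤ D.ι.range) (hD' : D'.e.ker ≤ D'.ι.range)
    (hq : 0 < q) (hx : (D'.e (D.ι (ofAdd x))).toAdd = q)
    (hz : (D.e (D'.ι (ofAdd z))).toAdd = q) :
    ∃ T : (Fin n → ℚ) ≃ₗ[ℚ] (Fin m → ℚ), ∀ v, T (f v) = f' (T v) := by
  obtain ⟨T, hTx, hT⟩ := exists_linearEquiv_of_ker_le hD hD' hq hx hz
  obtain ⟨ε, hε⟩ := exists_linearMap_extending
    (MonoidHom.toAdditiveLeft (β := ℤ) (D'.e.comp D.ι))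
  obtain ⟨ε', hε'⟩ := exists_linearMap_extending
    (MonoidHom.toAdditiveLeft (β := ℤ) (D.e.comp D'.ι))
  replace hε : ∀ w, ε (ZtoQ n w) = (D'.e (D.ι (ofAdd w))).toAdd := hε
  replace hε' : ∀ w, ε' (ZtoQ m w) = (D.e (D'.ι (ofAdd w))).toAdd := hε'
  have hεT : ∀ v, ε' (T v) = ε v := fun v => by
    suffices ε' ∘ₗ T.toLinearMap = ε from LinearMap.congr_fun this v
    refine linearMap_ext_ZtoQ fun w => ⟨q, hq, ?_⟩
    obtain ⟨a, b, hab, h⟩ := exists_nsmul_eq_add hD' hx w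
    have ha : ε (ZtoQ n a) = 0 := by rw [hε, hab, D'.e_ι]; simp
    have hb : ε' (ZtoQ m b) = 0 := by rw [hε', ← hab, D.e_ι]; simp
    rw [h, LinearMap.comp_apply, LinearEquiv.coe_coe]
    simp only [map_add, map_zsmul, hT _ _ hab, hTx, ha, hb, hε, hε', hx, hz]
  have hconj := apply_zpow_eq hD hD' hT hε
  let g := (T ≪≫ₗ f') ≪≫ₗ T.symm
  have hTg : ∀ v, T (g v) = f' (T v) := fun v => T.apply_symm_apply _
  obtain ⟨x', hx'⟩ := exists_conj_eq hD (D'.ι (ofAdd z)) x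
  obtain ⟨z', hz'⟩ := exists_conj_eq hD' (D.ι (ofAdd x)) z
  have hfx := D.conj_eq _ _ _ hx'
  have hfz := D'.conj_eq _ _ _ hz'
  rw [hz, zpow_natCast] at hfx
  rw [hx] at hfz
  obtain ⟨Θ, hΘ⟩ := exists_conj_of_restrictKer (f := f) (g := g) (ε := ε) (x := ZtoQ n x) hq
    (by rw [hε, hx]; rfl) (D.apply_eq_of_apply_ZtoQ_eq D'.e hε)
    (fun v => by
      rw [← hεT, hTg, D'.apply_eq_of_apply_ZtoQ_eq D.e hε', hεT])
    (fun w hw => by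
      apply T.injective
      have := hconj (D'.ι (ofAdd z)) w hw
      rwa [hz, D'.e_ι, toAdd_one, zpow_zero, zpow_natCast] at this)
    (α := (D.e D'.t).toAdd) (β := (D'.e D.t).toAdd)
    (fun w hw => by
      apply T.injective
      have := hconj D'.t w hw
      rwa [D'.e_t, toAdd_ofAdd, zpow_one, ← hTg, eq_comm] at this)
    (fun w hw => by
      apply T.injective
      have := hconj D.t w hw
      rwa [D.e_t, toAdd_ofAdd, zpow_one, ← LinearEquiv.semiconj_zpow hTg] at this)
    (by
      apply T.injective
      have h : T (ZtoQ n (x' - x)) = ZtoQ m (z - z') := by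
        apply hT
        rw [ofAdd_sub, ofAdd_sub, map_div, map_div, ← hx', ← hz', div_eq_mul_inv, div_eq_mul_inv]
        group
      rw [map_sub, map_sub] at h
      rw [map_neg, map_sub, ← zpow_natCast, LinearEquiv.semiconj_zpow hTg, hTx, ← hfz, ← hfx, map_sub, h,
        map_sub]
      abel)
  exact ⟨Θ ≪≫ₗ T, fun v => by rw [LinearEquiv.trans_apply, hΘ, hTg]; rfl⟩

end Normal

theorem exists_conj_of_not_commensurable {v : Multiplicative (Fin m → ℤ)}
    (hv : ∀ N : ℕ, 0 < N → D'.ι v ^ N ∉ D.ι.range) :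
    ∃ T : (Fin n → ℚ) ≃ₗ[ℚ] (Fin m → ℚ), ∀ v, T (f v) = f' (T v) := by
  have hD := D.ker_e_le_range_of_pow_notMem D' hv
  have hv0 : (D.e (D'.ι v)).toAdd ≠ 0 := fun h =>
    hv 1 one_pos (by rw [pow_one]; exact hD (toAdd.injective h))
  obtain ⟨z, q, hq, hz⟩ : ∃ z, ∃ q : ℕ, 0 < q ∧ (D.e (D'.ι (ofAdd z))).toAdd = q := by
    rcases Int.natAbs_eq (D.e (D'.ι v)).toAdd with h | h
    · exact ⟨toAdd v, _, Int.natAbs_pos.2 hv0, h⟩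
    · refine ⟨toAdd v⁻¹, _, Int.natAbs_pos.2 hv0, ?_⟩
      rw [ofAdd_toAdd, map_inv, map_inv, toAdd_inv]
      omega
  obtain ⟨x, hx⟩ := @hD (D'.t ^ q * D'.ι (ofAdd z) ^ (-(D.e D'.t).toAdd)) (by
    rw [MonoidHom.mem_ker]
    apply toAdd.injective
    simp [hz, mul_comm])
  have hx' : (D'.e (D.ι x)).toAdd = q := by
    rw [hx]
    simp [D'.e_t, D'.e_ι]
  refine exists_conj_of_ker_le hD (D'.ker_e_le_range_of_pow_notMem D (v := x) fun N hN h => ?_)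
    hq hx' hz
  have := D'.mem_ker_of_pow_mem hN h
  rw [MonoidHom.mem_ker] at this
  rw [this, toAdd_one] at hx'
  omega

/-- The group determines the conjugacy class of the linear map up to inversion. -/
theorem exists_conj (D : LMData G n f) (D' : LMData G m f') : ∃ T : (Fin n → ℚ) ≃ₗ[ℚ] (Fin m → ℚ),
    (∀ v, T (f v) = f' (T v)) ∨ (∀ v, T (f v) = f'.symm (T v)) := by
  by_cases h : ∀ v, ∃ N : ℕ, 0 < N ∧ D.ι v ^ N ∈ D'.ι.range
  · by_cases h' : ∀ v, ∃ N : ℕ, 0 < N ∧ D'.ι v ^ N ∈ D.ι.range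
    · exact D.exists_conj_of_commensurable D' h h'
    · push Not at h'
      obtain ⟨v, hv⟩ := h'
      obtain ⟨T, hT⟩ := D.exists_conj_of_not_commensurable D' hv
      exact ⟨T, .inl hT⟩
  · push Not at h
    obtain ⟨v, hv⟩ := h
    obtain ⟨T, hT⟩ := D'.exists_conj_of_not_commensurable D hv
    exact ⟨T.symm, .inl fun v => by
      rw [T.symm_apply_eq, hT, T.apply_symm_apply]⟩

end LMData

section HNN

variable {n : ℕ} {f : (Fin n → ℚ) ≃ₗ[ℚ] (Fin n → ℚ)}
  {A B : Subgroup (Multiplicative (Fin n → ℤ))} {φ : A ≃* B}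

namespace HNNExtension

open Multiplicative

/-- The exponent of the stable letter. -/
def exponent {H : Type*} [Group H] {A B : Subgroup H} (φ : A ≃* B) :
    HNNExtension H A B φ →* Multiplicative ℤ :=
  lift 1 (ofAdd 1) fun _ => by simp

/-- The action of an HNN extension of `ℤ^n` by affine maps. -/
def affineAction (hφ : ∀ a, ZtoQ n (toAdd (φ a : Multiplicative (Fin n → ℤ))) =
      f (ZtoQ n (toAdd (a : Multiplicative (Fin n → ℤ))))) :
    HNNExtension (Multiplicative (Fin n → ℤ)) A B φ →* Equiv.Perm (Fin n → ℚ) :=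
  lift (MonoidHom.mk' (fun v => Equiv.addLeft (ZtoQ n (toAdd v)))
    fun v w => by ext1 x; simp) f.toEquiv fun a => by ext1 x; simp [hφ]

theorem affineAction_sub (hφ : ∀ a, ZtoQ n (toAdd (φ a : Multiplicative (Fin n → ℤ))) =
      f (ZtoQ n (toAdd (a : Multiplicative (Fin n → ℤ)))))
    (g : HNNExtension (Multiplicative (Fin n → ℤ)) A B φ) (x y : Fin n → ℚ) :
    affineAction hφ g x - affineAction hφ g y = (f ^ (exponent φ g).toAdd) (x - y) := by
  induction g using induction_on generalizing x y with
  | of v => simp [affineAction, exponent]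
  | t => simp [affineAction, exponent]
  | mul g h ihg ihh => rw [map_mul, map_mul, Equiv.Perm.mul_apply, Equiv.Perm.mul_apply, ihg, ihh,
      toAdd_mul, _root_.zpow_add, LinearEquiv.mul_apply]
  | inv g ih =>
    rw [map_inv, map_inv, toAdd_inv, _root_.zpow_neg]
    apply (f ^ (exponent φ g).toAdd).injective
    rw [← ih, ← LinearEquiv.mul_apply, mul_inv_cancel]
    simp

theorem exists_conj_pow_mem_range_of {H : Type*} [CommGroup H] {A B : Subgroup H} {φ : A ≃* B}
    (hA : ∀ v, ∃ N : ℕ, 0 < N ∧ v ^ N ∈ A) (hB : ∀ v, ∃ N : ℕ, 0 < N ∧ v ^ N ∈ B)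
    (g : HNNExtension H A B φ) (v : H) :
    ∃ N : ℕ, 0 < N ∧ g * of v ^ N * g⁻¹ ∈ (of : H →* HNNExtension H A B φ).range := by
  suffices h : (∀ v, ∃ N : ℕ, 0 < N ∧ g * of v ^ N * g⁻¹ ∈
        (of : H →* HNNExtension H A B φ).range) ∧
      ∀ v, ∃ N : ℕ, 0 < N ∧ g⁻¹ * of v ^ N * g ∈ (of : H →* HNNExtension H A B φ).range from h.1 v
  induction g using induction_on with
  | of w => exact ⟨fun v => ⟨1, one_pos, w * v ^ 1 * w⁻¹, by simp only [map_mul, map_inv, map_pow]⟩,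
      fun v => ⟨1, one_pos, w⁻¹ * v ^ 1 * w, by simp only [map_mul, map_inv, map_pow]⟩⟩
  | t =>
    refine ⟨fun v => ?_, fun v => ?_⟩
    · obtain ⟨N, hN, h⟩ := hA v
      exact ⟨N, hN, φ ⟨_, h⟩, by rw [equiv_eq_conj]; simp⟩
    · obtain ⟨N, hN, h⟩ := hB v
      exact ⟨N, hN, φ.symm ⟨_, h⟩, by rw [equiv_symm_eq_conj]; simp⟩
  | mul g h ihg ihh =>
    refine ⟨fun v => ?_, fun v => ?_⟩
    · obtain ⟨N, hN, w, hw⟩ := ihh.1 v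
      obtain ⟨M, hM, h'⟩ := ihg.1 w
      refine ⟨N * M, by positivity, ?_⟩
      convert! h' using 1
      rw [hw, conj_pow, ← pow_mul]
      simp only [mul_assoc, _root_.mul_inv_rev]
    · obtain ⟨N, hN, w, hw⟩ := ihg.2 v
      obtain ⟨M, hM, h'⟩ := ihh.2 w
      refine ⟨N * M, by positivity, ?_⟩
      convert! h' using 1
      have := conj_pow (i := M) (a := g⁻¹) (b := of v ^ N)
      rw [inv_inv] at this
      rw [hw, this, ← pow_mul]
      simp only [mul_assoc, _root_.mul_inv_rev]
  | inv g ih => exact ⟨by simpa using ih.2, by simpa using ih.1⟩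

theorem normal_range_of {H : Type*} [Group H] {A B : Subgroup H} {φ : A ≃* B}
    (hA : A = ⊤) (hB : B = ⊤) : (of : H →* HNNExtension H A B φ).range.Normal := by
  refine ⟨?_⟩
  rintro _ ⟨v, rfl⟩ g
  suffices h : (∀ v, g * of v * g⁻¹ ∈ (of : H →* HNNExtension H A B φ).range) ∧
      ∀ v, g⁻¹ * of v * g ∈ (of : H →* HNNExtension H A B φ).range from h.1 v
  induction g using induction_on with
  | of w => exact ⟨fun v => ⟨w * v * w⁻¹, by simp⟩, fun v => ⟨w⁻¹ * v * w, by simp⟩⟩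
  | t => exact ⟨fun v => ⟨φ ⟨v, by simp [hA]⟩, equiv_eq_conj _⟩,
      fun v => ⟨φ.symm ⟨v, by simp [hB]⟩, equiv_symm_eq_conj _⟩⟩
  | mul g h ihg ihh =>
    refine ⟨fun v => ?_, fun v => ?_⟩
    · obtain ⟨w, hw⟩ := ihh.1 v
      convert! ihg.1 w using 1
      simp only [hw, mul_assoc, _root_.mul_inv_rev]
    · obtain ⟨w, hw⟩ := ihg.2 v
      convert! ihh.2 w using 1
      simp only [hw, mul_assoc, _root_.mul_inv_rev]
  | inv g ih => exact ⟨by simpa using ih.2, by simpa using ih.1⟩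

theorem ker_exponent_le {H : Type*} [Group H] {A B : Subgroup H} {φ : A ≃* B}
    (S : Subgroup (HNNExtension H A B φ)) [S.Normal]
    (hS : (of : H →* HNNExtension H A B φ).range ≤ S) : (exponent φ).ker ≤ S := by
  have h : QuotientGroup.mk' S = (zpowersHom _ (QuotientGroup.mk' S t)).comp (exponent φ) := by
    ext v
    · have : QuotientGroup.mk' S (of v) = 1 := (QuotientGroup.eq_one_iff _).2 (hS ⟨v, rfl⟩)
      simpa [exponent] using this
    · simp [exponent]
  intro g hg
  rw [← QuotientGroup.eq_one_iff, ← QuotientGroup.mk'_apply, h, MonoidHom.comp_apply,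
    MonoidHom.mem_ker.1 hg, map_one]

end HNNExtension

open HNNExtension in
/-- The data attached to an HNN extension of `ℤ^n` along subgroups of finite index. -/
def LMData.ofHNNExtension (hφ : ∀ a, ZtoQ n (φ a : Multiplicative (Fin n → ℤ)).toAdd =
      f (ZtoQ n (a : Multiplicative (Fin n → ℤ)).toAdd))
    (hA : ∀ v, ∃ N : ℕ, 0 < N ∧ v ^ N ∈ A) (hB : ∀ v, ∃ N : ℕ, 0 < N ∧ v ^ N ∈ B) :
    LMData (HNNExtension (Multiplicative (Fin n → ℤ)) A B φ) n f where
  ι := of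
  e := exponent φ
  t := HNNExtension.t
  ι_injective := of_injective φ
  e_ι v := by simp [exponent]
  e_t := by simp [exponent]
  conj_eq g v w h := by
    have h' := affineAction_sub hφ g (ZtoQ n v) 0
    have : affineAction hφ g (ZtoQ n v) = ZtoQ n w + affineAction hφ g 0 := by
      have := congrArg (fun σ => affineAction hφ σ 0) (mul_inv_eq_iff_eq_mul.1 h)
      simpa [affineAction] using this
    simpa [this] using h'
  exists_conj_pow_mem := exists_conj_pow_mem_range_of hA hB
  ker_e_le S hS hle := ker_exponent_le S hle
  ker_e_le_range k hk := by
    by_cases h : ∃ g, g * k * g⁻¹ ∈ (of : _ →* HNNExtension _ A B φ).range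
    · left
      obtain ⟨g, w, hw⟩ := h
      obtain ⟨N, hN, hr⟩ := exists_conj_pow_mem_range_of hA hB g⁻¹ w
      refine ⟨N, hN, ?_⟩
      convert! hr using 1
      rw [hw, conj_pow]
      group
    · right
      push Not at h
      obtain ⟨hA', hB'⟩ := eq_top_of_commute_conj h hk
      have := normal_range_of (φ := φ) hA' hB'
      exact ker_exponent_le _ le_rfl

/-- Transport along an isomorphism of groups. -/
def LMData.congr {G K : Type*} [Group G] [Group K] (D : LMData G n f) (E : G ≃* K) :
    LMData K n f where
  ι := E.toMonoidHom.comp D.ι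
  e := D.e.comp E.symm.toMonoidHom
  t := E D.t
  ι_injective := E.injective.comp D.ι_injective
  e_ι v := by simp [D.e_ι]
  e_t := by simp [D.e_t]
  conj_eq g v w h := by
    apply D.conj_eq (E.symm g) v w
    apply E.injective
    simpa using h
  exists_conj_pow_mem g v := by
    obtain ⟨N, hN, w, hw⟩ := D.exists_conj_pow_mem (E.symm g) v
    exact ⟨N, hN, w, by simp [hw]⟩
  ker_e_le S hS h g hg := by
    have := D.ker_e_le (S.comap E.toMonoidHom) inferInstance (by
      rintro _ ⟨v, rfl⟩
      exact h ⟨v, rfl⟩) (x := E.symm g) hg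
    simpa using this
  ker_e_le_range k hk := by
    refine (D.ker_e_le_range (E.symm k) fun g => ?_).imp ?_ fun h g hg => ?_
    · obtain ⟨N, hN, h⟩ := hk (E g)
      exact ⟨N, hN, by simpa using h.map E.symm⟩
    · rintro ⟨N, hN, w, hw⟩
      exact ⟨N, hN, w, by simp [hw]⟩
    · obtain ⟨w, hw⟩ := @h (E.symm g) hg
      exact ⟨w, by simp [hw]⟩

end HNN

section Presentation

open Multiplicative

theorem prod_ofFn_zpow_add {G : Type*} [Group G] {n : ℕ} (g : Fin n → G)
    (hg : ∀ i j, Commute (g i) (g j)) (v w : Fin n → ℤ) :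
    (List.ofFn fun i => g i ^ (v i + w i)).prod =
      (List.ofFn fun i => g i ^ v i).prod * (List.ofFn fun i => g i ^ w i).prod := by
  induction n with
  | zero => simp
  | succ n ih =>
    have h : Commute (g 0 ^ w 0) (List.ofFn fun i : Fin n => g i.succ ^ v i.succ).prod := by
      apply Commute.list_prod_right
      simp only [List.mem_ofFn, forall_exists_index, forall_apply_eq_imp_iff]
      exact fun i => (hg _ _).zpow_zpow _ _
    rw [List.ofFn_succ, List.ofFn_succ, List.ofFn_succ, List.prod_cons, List.prod_cons,
      List.prod_cons, ih (fun i => g i.succ) (fun i j => hg _ _) (fun i => v i.succ)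
      fun i => w i.succ, _root_.zpow_add, mul_assoc, mul_assoc, h.left_comm]

theorem prod_ofFn_zpow_single {G : Type*} [Group G] {n : ℕ} (g : Fin n → G) (j : Fin n) :
    (List.ofFn fun i => g i ^ (Pi.single j 1 : Fin n → ℤ) i).prod = g j := by
  induction n with
  | zero => exact j.elim0
  | succ n ih =>
    rw [List.ofFn_succ, List.prod_cons]
    cases j using Fin.cases with
    | zero => simp [Fin.succ_ne_zero]
    | succ j =>
      convert! ih (fun i => g i.succ) j using 1
      simp [Pi.single_apply, (Fin.succ_ne_zero j).symm]

variable {n : ℕ} {A : Matrix (Fin n) (Fin n) ℚ} {L : AddSubgroup (Fin n → ℤ)}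

theorem commute_Xg (i j : Fin n) : Commute (Xg n A L i) (Xg n A L j) := by
  have h : PresentedGroup.mk (LMrels n A L) _ = 1 :=
    PresentedGroup.one_of_mem (.inl ⟨i, j, rfl⟩)
  simp only [map_mul, map_inv] at h
  exact mul_inv_eq_iff_eq_mul.1 (mul_inv_eq_one.1 h)

theorem mk_xWord (v : Fin n → ℤ) : PresentedGroup.mk (LMrels n A L) (xWord n v) = Xv n A L v := by
  rw [xWord, map_list_prod, List.map_ofFn, Xv]
  simp only [Function.comp_def, map_zpow]
  rfl

theorem lift_xWord {G : Type*} [Group G] (ι : Multiplicative (Fin n → ℤ) →* G) (s : G)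
    (v : Fin n → ℤ) :
    FreeGroup.lift (Sum.elim (fun i => ι (ofAdd (Pi.single i 1))) fun _ => s) (xWord n v) =
      ι (ofAdd v) := by
  rw [xWord, map_list_prod, List.map_ofFn]
  simp only [Function.comp_def, map_zpow, FreeGroup.lift_apply_of, Sum.elim_inl]
  simp only [← map_zpow]
  rw [show (List.ofFn fun i => ι (ofAdd (Pi.single i 1) ^ v i)) =
    List.map ι (List.ofFn fun i => ofAdd (Pi.single i 1) ^ v i) by rw [List.map_ofFn]; rfl,
    ← map_list_prod, List.prod_ofFn]
  congr 1
  apply toAdd.injective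
  ext j
  simp [toAdd_prod, Pi.single_apply]

/-- The map `v ↦ x^v`. -/
def XvHom (n : ℕ) (A : Matrix (Fin n) (Fin n) ℚ) (L : AddSubgroup (Fin n → ℤ)) :
    Multiplicative (Fin n → ℤ) →* LM n A L :=
  MonoidHom.mk' (fun v => Xv n A L (toAdd v)) fun v w =>
    prod_ofFn_zpow_add _ commute_Xg (toAdd v) (toAdd w)

theorem Tg_mul_Xv {v w : Fin n → ℤ} (hv : v ∈ L) (hw : ZtoQ n w = A.mulVec (ZtoQ n v)) :
    Tg n A L * Xv n A L v = Xv n A L w * Tg n A L := by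
  have h : PresentedGroup.mk (LMrels n A L) _ = 1 :=
    PresentedGroup.one_of_mem (.inr ⟨v, hv, w, hw, rfl⟩)
  simp only [map_mul, map_inv, mk_xWord] at h
  exact mul_inv_eq_iff_eq_mul.1 (mul_inv_eq_one.1 h)

theorem exists_mulEquiv_ALsub (hA : IsUnit A.det) (hLA : QImage A L ≤ (ZtoQ n).range) :
    ∃ φ : L.toSubgroup ≃* (ALsub A L).toSubgroup,
      ∀ a, ZtoQ n (toAdd (φ a : Multiplicative (Fin n → ℤ))) =
        A.mulVec (ZtoQ n (toAdd (a : Multiplicative (Fin n → ℤ)))) := by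
  have hmem : ∀ a : L.toSubgroup,
      A.mulVec (ZtoQ n (toAdd (a : Multiplicative (Fin n → ℤ)))) ∈ QImage A L := fun a =>
    ⟨_, ⟨_, a.2, rfl⟩, rfl⟩
  choose F hF using fun a => hLA (hmem a)
  let φ : L.toSubgroup →* (ALsub A L).toSubgroup :=
    MonoidHom.mk' (fun a => ⟨ofAdd (F a), by
      change ZtoQ n (F a) ∈ QImage A L
      rw [hF]
      exact hmem a⟩) fun a b => by
        ext1
        apply toAdd.injective
        apply ZtoQ_injective
        change ZtoQ n (F (a * b)) = ZtoQ n (F a + F b)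
        rw [map_add, hF, hF, hF, ← Matrix.mulVec_add, ← map_add]
        rfl
  refine ⟨MulEquiv.ofBijective φ ⟨fun a b h => ?_, ?_⟩, hF⟩
  · have h' : F a = F b := congrArg (fun c : (ALsub A L).toSubgroup => toAdd (c : Multiplicative (Fin n → ℤ))) h
    have := hF a
    rw [h', hF] at this
    ext1
    exact toAdd.injective (ZtoQ_injective (Matrix.mulVec_injective_of_isUnit
      ((Matrix.isUnit_iff_isUnit_det _).2 hA) this.symm))
  · rintro ⟨w, _, ⟨v, hv, rfl⟩, hw⟩
    refine ⟨⟨ofAdd v, hv⟩, ?_⟩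
    ext1
    exact toAdd.injective (ZtoQ_injective ((hF _).trans hw))

/-- The group `G(A,L)` is an HNN extension of `ℤ^n`. -/
theorem nonempty_LM_mulEquiv
    {φ : L.toSubgroup ≃* (ALsub A L).toSubgroup}
    (hφ : ∀ a, ZtoQ n (toAdd (φ a : Multiplicative (Fin n → ℤ))) =
        A.mulVec (ZtoQ n (toAdd (a : Multiplicative (Fin n → ℤ))))) :
    Nonempty (HNNExtension (Multiplicative (Fin n → ℤ)) L.toSubgroup (ALsub A L).toSubgroup φ ≃*
      LM n A L) := by
  let F : LM n A L →*
      HNNExtension (Multiplicative (Fin n → ℤ)) L.toSubgroup (ALsub A L).toSubgroup φ :=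
    PresentedGroup.toGroup
      (f := Sum.elim (fun i => HNNExtension.of (ofAdd (Pi.single i 1))) fun _ => HNNExtension.t) (by
      rintro r (⟨i, j, rfl⟩ | ⟨v, hv, w, hw, rfl⟩)
      · simp only [map_mul, map_inv, FreeGroup.lift_apply_of, Sum.elim_inl]
        rw [mul_inv_eq_one, mul_inv_eq_iff_eq_mul]
        exact (Commute.all _ _).map _
      · rw [map_mul, map_inv, lift_xWord, map_mul, map_mul, map_inv, lift_xWord,
          FreeGroup.lift_apply_of, Sum.elim_inr, mul_inv_eq_one]
        have : w = toAdd (φ ⟨ofAdd v, hv⟩ : Multiplicative (Fin n → ℤ)) :=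
          ZtoQ_injective (hw.trans (hφ ⟨ofAdd v, hv⟩).symm)
        rw [this, ofAdd_toAdd]
        have h := HNNExtension.equiv_eq_conj (φ := φ) ⟨ofAdd v, hv⟩
        exact h.symm)
  have ht : ∀ a : L.toSubgroup, Tg n A L * XvHom n A L a = XvHom n A L (φ a) * Tg n A L :=
    fun a => Tg_mul_Xv a.2 (hφ a)
  refine ⟨MonoidHom.toMulEquiv (HNNExtension.lift (XvHom n A L) (Tg n A L) ht) F ?_ ?_⟩
  · refine HNNExtension.hom_ext (MonoidHom.ext fun v => ?_) ?_
    · rw [MonoidHom.comp_apply, MonoidHom.comp_apply, HNNExtension.lift_of]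
      change F (Xv n A L (toAdd v)) = _
      rw [← mk_xWord]
      exact lift_xWord _ _ _
    · rw [MonoidHom.comp_apply, HNNExtension.lift_t]
      exact PresentedGroup.toGroup.of _
  · refine PresentedGroup.ext fun a => ?_
    rcases a with i | u
    · rw [MonoidHom.comp_apply, PresentedGroup.toGroup.of, Sum.elim_inl, HNNExtension.lift_of]
      exact prod_ofFn_zpow_single _ _
    · rw [MonoidHom.comp_apply, PresentedGroup.toGroup.of, Sum.elim_inr, HNNExtension.lift_t]
      rfl

theorem exists_pow_mem_toSubgroup (hL : L.FiniteIndex) (v : Multiplicative (Fin n → ℤ)) :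
    ∃ N : ℕ, 0 < N ∧ v ^ N ∈ L.toSubgroup := by
  obtain ⟨N, hN, -, h⟩ := AddSubgroup.exists_nsmul_mem_of_index_ne_zero hL.index_ne_zero (toAdd v)
  exact ⟨N, hN, h⟩

theorem exists_pow_mem_toSubgroup_ALsub (hA : IsUnit A.det) (hL : L.FiniteIndex)
    (v : Multiplicative (Fin n → ℤ)) : ∃ N : ℕ, 0 < N ∧ v ^ N ∈ (ALsub A L).toSubgroup := by
  obtain ⟨N, hN, w, hw⟩ := exists_nsmul_eq_ZtoQ (A⁻¹.mulVec (ZtoQ n (toAdd v)))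
  obtain ⟨M, hM, hr⟩ := exists_pow_mem_toSubgroup hL (ofAdd w)
  refine ⟨M * N, by positivity, _, ⟨_, hr, rfl⟩, ?_⟩
  change A.mulVec (ZtoQ n (M • w)) = ZtoQ n ((M * N) • toAdd v)
  rw [map_nsmul, ← hw, Matrix.mulVec_smul, Matrix.mulVec_smul, Matrix.mulVec_mulVec,
    Matrix.mul_nonsing_inv _ hA, Matrix.one_mulVec, mul_smul, map_nsmul, map_nsmul]

theorem nonempty_LMData (hA : IsUnit A.det) (hL : L.FiniteIndex)
    (hLA : QImage A L ≤ (ZtoQ n).range) {f : (Fin n → ℚ) ≃ₗ[ℚ] (Fin n → ℚ)}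
    (hf : ∀ v, f v = A.mulVec v) : Nonempty (LMData (LM n A L) n f) := by
  obtain ⟨φ, hφ⟩ := exists_mulEquiv_ALsub hA hLA
  obtain ⟨E⟩ := nonempty_LM_mulEquiv hφ
  exact ⟨(LMData.ofHNNExtension (fun a => by rw [hf, hφ]) (exists_pow_mem_toSubgroup hL)
    (exists_pow_mem_toSubgroup_ALsub hA hL)).congr E⟩

end Presentation

/-- **Corollary.** If `G(A,L) ≅ G(Ā,L̄)` then `n = n̄` and `Ā` is conjugate in `GL_n(ℚ)`
to `A` or to `A⁻¹`. -/
theorem LM_isomorphism_conjugate_over_Q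
    (n nb : ℕ) (A : Matrix (Fin n) (Fin n) ℚ) (Ab : Matrix (Fin nb) (Fin nb) ℚ)
    (hA : IsUnit A.det) (hAb : IsUnit Ab.det)
    (L : AddSubgroup (Fin n → ℤ)) (Lb : AddSubgroup (Fin nb → ℤ))
    (hL : L.FiniteIndex) (hLb : Lb.FiniteIndex)
    (hLA : QImage A L ≤ (ZtoQ n).range) (hLAb : QImage Ab Lb ≤ (ZtoQ nb).range)
    (hiso : Nonempty (LM n A L ≃* LM nb Ab Lb)) :
    ∃ h : nb = n, ∃ B : Matrix (Fin n) (Fin n) ℚ, IsUnit B.det ∧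
      (Matrix.reindex (finCongr h) (finCongr h) Ab = B * A * B⁻¹ ∨
       Matrix.reindex (finCongr h) (finCongr h) Ab = B * A⁻¹ * B⁻¹) := by
  have hexists : ∀ {k : ℕ} {M : Matrix (Fin k) (Fin k) ℚ}, IsUnit M.det →
      ∃ f : (Fin k → ℚ) ≃ₗ[ℚ] (Fin k → ℚ), ∀ v, f v = M.mulVec v := fun hM =>
    ⟨Matrix.toLinearEquiv' _ (Matrix.invertibleOfIsUnitDet _ hM), fun _ => rfl⟩
  obtain ⟨f, hf⟩ := hexists hA
  obtain ⟨fb, hfb⟩ := hexists hAb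
  obtain ⟨D⟩ := nonempty_LMData hA hL hLA hf
  obtain ⟨Db⟩ := nonempty_LMData hAb hLb hLAb hfb
  obtain ⟨E⟩ := hiso
  obtain ⟨T, hT⟩ := (D.congr E).exists_conj Db
  have h : nb = n := by simpa using T.finrank_eq.symm
  subst h
  have hB : IsUnit (LinearMap.toMatrix' T.toLinearMap).det := by
    rw [LinearMap.det_toMatrix']
    exact T.isUnit_det'
  have hBT : ∀ v, LinearMap.toMatrix' T.toLinearMap *ᵥ v = T v := fun v => by
    rw [LinearMap.toMatrix'_mulVec]; rfl
  have hconj : ∀ {M : Matrix (Fin nb) (Fin nb) ℚ}, (∀ v, T (M *ᵥ v) = Ab *ᵥ T v) →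
      Matrix.reindex (finCongr rfl) (finCongr rfl) Ab =
        LinearMap.toMatrix' T.toLinearMap * M * (LinearMap.toMatrix' T.toLinearMap)⁻¹ := by
    intro M hM
    rw [finCongr_refl, Matrix.reindex_refl_refl]
    have := Matrix.invertibleOfIsUnitDet _ hB
    rw [eq_comm, Matrix.mul_inv_eq_iff_eq_mul_of_invertible]
    refine Matrix.mulVec_injective (funext fun v => ?_)
    rw [← Matrix.mulVec_mulVec, ← Matrix.mulVec_mulVec, hBT, hBT, hM]
  refine ⟨rfl, LinearMap.toMatrix' T.toLinearMap, hB, hT.imp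
    (fun hT => hconj fun v => by rw [← hf, hT, hfb])
    fun hT => hconj fun v => ?_⟩
  have h := hT (A⁻¹ *ᵥ v)
  rwa [hf, Matrix.mulVec_mulVec, Matrix.mul_nonsing_inv _ hA, Matrix.one_mulVec, eq_comm,
    LinearEquiv.symm_apply_eq, hfb] at h
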